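/- Let S be a finite nonempty training index set and Y a finite nonempty label set, with for each s ∈ S a training label y_s ∈ Y, a loss ℓ_s : Y → ℝ, and features φ_k(s,·) : Y → ℝ for k in a finite index set K. Let ε > 0 and C > 0. Then strong duality holds: inf over w ∈ ℝ^K of ∑_{s∈S} [ ε·log( ∑_{ŷ∈Y} exp( (ℓ_s(ŷ) + ∑_{k} w_k φ_k(s,ŷ)) / ε ) ) − ∑_k w_k φ_k(s,y_s) ] + (C/2)·∑_k w_k² equals the sup over families of probability distributions (p_s)_{s∈S} on Y of ∑_{s∈S} ( ε·H(p_s) + ∑_{ŷ} p_s(ŷ)ℓ_s(ŷ) ) − (1/(2C))·∑_{k∈K} ( ∑_{s∈S} ( ∑_{ŷ} p_s(ŷ)φ_k(s,ŷ) − φ_k(s,y_s) ) )², and both values are finite and attained in the dual. -/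

import Mathlib

lemma ell_gibbs {Y : Type*} [Fintype Y] [Nonempty Y] (p a : Y → ℝ) (ε : ℝ) (hε : 0 < ε)
    (hp : ∀ y, 0 ≤ p y) (h1 : ∑ y, p y = 1) :
    ε * (-∑ y, p y * Real.log (p y)) + ∑ y, p y * a y
      ≤ ε * Real.log (∑ y, Real.exp (a y / ε)) := by
  set Z := ∑ y, Real.exp (a y / ε) with hZ
  have hZpos : 0 < Z := Finset.sum_pos (fun _ _ => Real.exp_pos _) Finset.univ_nonempty
  have key : ∀ y, p y * (a y / ε - Real.log Z - Real.log (p y)) ≤ Real.exp (a y / ε) / Z - p y := by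
    intro y
    rcases (hp y).eq_or_lt with h | h
    · rw [← h]; simp; positivity
    · have hq : 0 < Real.exp (a y / ε) / Z := by positivity
      have := Real.log_le_sub_one_of_pos (div_pos hq h)
      rw [Real.log_div hq.ne' h.ne', Real.log_div (Real.exp_pos _).ne' hZpos.ne', Real.log_exp] at this
      calc _ ≤ p y * (Real.exp (a y / ε) / Z / p y - 1) := mul_le_mul_of_nonneg_left this h.le
        _ = _ := by field_simp
  have hs := Finset.sum_le_sum (fun y (_ : y ∈ Finset.univ) => key y)
  rw [Finset.sum_sub_distrib, ← Finset.sum_div, ← hZ, div_self hZpos.ne', h1] at hs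
  have e : ∑ y, p y * (a y / ε - Real.log Z - Real.log (p y))
      = (∑ y, p y * a y) / ε - Real.log Z - ∑ y, p y * Real.log (p y) := by
    simp only [mul_sub, Finset.sum_sub_distrib, ← Finset.sum_mul, h1, one_mul, Finset.sum_div, mul_div_assoc]
  rw [e] at hs
  have h2 := mul_le_mul_of_nonneg_left hs hε.le
  have h3 : ε * ((∑ y, p y * a y) / ε) = ∑ y, p y * a y := by field_simp
  simp only [mul_sub, h3] at h2
  linarith

lemma ell_gibbs_eq {Y : Type*} [Fintype Y] [Nonempty Y] (a : Y → ℝ) (ε : ℝ) (hε : 0 < ε)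
    (p : Y → ℝ) (hp : ∀ y, p y = Real.exp (a y / ε) / ∑ y, Real.exp (a y / ε)) :
    (∀ y, 0 ≤ p y) ∧ (∑ y, p y = 1) ∧
    ε * (-∑ y, p y * Real.log (p y)) + ∑ y, p y * a y
      = ε * Real.log (∑ y, Real.exp (a y / ε)) := by
  set Z := ∑ y, Real.exp (a y / ε) with hZ
  have hZpos : 0 < Z := Finset.sum_pos (fun _ _ => Real.exp_pos _) Finset.univ_nonempty
  have h1 : ∑ y, p y = 1 := by
    simp only [hp]; rw [← Finset.sum_div, ← hZ, div_self hZpos.ne']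
  refine ⟨fun y => by rw [hp]; positivity, h1, ?_⟩
  have hl : ∀ y, Real.log (p y) = a y / ε - Real.log Z := by
    intro y
    rw [hp, Real.log_div (Real.exp_pos _).ne' hZpos.ne', Real.log_exp]
  simp only [hl, mul_sub, Finset.sum_sub_distrib, ← Finset.sum_mul, h1, one_mul, ← mul_div_assoc, ← Finset.sum_div]
  field_simp
  ring

lemma ell_lin {S Y K : Type*} [Fintype S] [Fintype Y] [Fintype K]
    (ytrain : S → Y) (ℓ : S → Y → ℝ) (φ : K → S → Y → ℝ) (p : S → Y → ℝ) (w : K → ℝ) :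
    ∑ s, ((∑ y, p s y * (ℓ s y + ∑ k, w k * φ k s y)) - ∑ k, w k * φ k s (ytrain s))
      = (∑ s, ∑ y, p s y * ℓ s y)
        + ∑ k, w k * (∑ s, ((∑ y, p s y * φ k s y) - φ k s (ytrain s))) := by
  simp only [Finset.mul_sum]
  rw [Finset.sum_comm (s := (Finset.univ : Finset K)), ← Finset.sum_add_distrib]
  refine Finset.sum_congr rfl fun s _ => ?_
  simp only [mul_add, mul_sub, Finset.sum_add_distrib, Finset.sum_sub_distrib, Finset.mul_sum]
  rw [Finset.sum_comm (s := (Finset.univ : Finset K))]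
  have : ∀ y k, p s y * (w k * φ k s y) = w k * (p s y * φ k s y) := fun y k => by ring
  simp only [this]
  ring

lemma ell_deriv {Y : Type*} [Fintype Y] [Nonempty Y] (a h : Y → ℝ) (ε : ℝ) (hε : 0 < ε) :
    HasDerivAt (fun t : ℝ => ε * Real.log (∑ y, Real.exp ((a y + t * h y) / ε)))
      (∑ y, (Real.exp (a y / ε) / ∑ y, Real.exp (a y / ε)) * h y) 0 := by
  have hZpos : 0 < ∑ y, Real.exp (a y / ε) :=
    Finset.sum_pos (fun _ _ => Real.exp_pos _) Finset.univ_nonempty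
  have h1 : ∀ y ∈ (Finset.univ : Finset Y), HasDerivAt (fun t : ℝ => Real.exp ((a y + t * h y) / ε))
      (Real.exp ((a y + 0 * h y) / ε) * ((1 * h y) / ε)) 0 := fun y _ =>
    ((((hasDerivAt_id (0:ℝ)).mul_const (h y)).const_add (a y)).div_const ε).exp
  have h2 := ((HasDerivAt.fun_sum h1).log (by simpa using hZpos.ne')).const_mul ε
  refine HasDerivAt.congr_deriv h2 (Eq.symm ?_)
  simp only [zero_mul, add_zero, one_mul, Finset.sum_div, Finset.mul_sum]
  refine Finset.sum_congr rfl fun y _ => ?_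
  field_simp

lemma ell_exists_min {S Y K : Type*}
    [Fintype S] [Fintype Y] [Nonempty Y] [Fintype K]
    (ytrain : S → Y) (ℓ : S → Y → ℝ) (φ : K → S → Y → ℝ)
    (ε C : ℝ) (hε : 0 < ε) (hC : 0 < C) (F : (K → ℝ) → ℝ) (hF : F = fun w =>
        (∑ s, (ε * Real.log (∑ y, Real.exp ((ℓ s y + ∑ k, w k * φ k s y) / ε))
            - ∑ k, w k * φ k s (ytrain s)))
          + (C / 2) * ∑ k, (w k) ^ 2) :
    ∃ w, ∀ v, F w ≤ F v := by
  have hpos : ∀ (w : K → ℝ) s, 0 < ∑ y, Real.exp ((ℓ s y + ∑ k, w k * φ k s y) / ε) :=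
    fun w s => Finset.sum_pos (fun _ _ => Real.exp_pos _) Finset.univ_nonempty
  have hcont : Continuous F := by
    rw [hF]
    refine Continuous.add (continuous_finsetSum _ fun s _ => Continuous.sub
      (continuous_const.mul (Continuous.log ?_ fun w => (hpos w s).ne')) ?_) ?_ <;> fun_prop
  have hlow : ∀ w, (∑ s, ℓ s (ytrain s)) + C / 2 * ‖w‖ ^ 2 ≤ F w := by
    intro w
    rw [hF]
    refine add_le_add (Finset.sum_le_sum fun s _ => ?_) (mul_le_mul_of_nonneg_left ?_ (by positivity))
    · have h1 : Real.exp ((ℓ s (ytrain s) + ∑ k, w k * φ k s (ytrain s)) / ε)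
          ≤ ∑ y, Real.exp ((ℓ s y + ∑ k, w k * φ k s y) / ε) :=
        Finset.single_le_sum (f := fun y => Real.exp ((ℓ s y + ∑ k, w k * φ k s y) / ε))
          (fun _ _ => (Real.exp_pos _).le) (Finset.mem_univ _)
      have h2 := Real.log_le_log (Real.exp_pos _) h1
      rw [Real.log_exp, div_le_iff₀ hε] at h2
      linarith
    · have hn : ‖w‖ ≤ Real.sqrt (∑ k, (w k) ^ 2) := by
        refine (pi_norm_le_iff_of_nonneg (Real.sqrt_nonneg _)).2 fun k => ?_
        refine Real.le_sqrt_of_sq_le ?_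
        rw [Real.norm_eq_abs, sq_abs]
        exact Finset.single_le_sum (f := fun k => (w k) ^ 2) (fun _ _ => sq_nonneg _) (Finset.mem_univ k)
      calc ‖w‖ ^ 2 ≤ Real.sqrt (∑ k, (w k) ^ 2) ^ 2 := by gcongr
        _ = _ := Real.sq_sqrt (Finset.sum_nonneg fun _ _ => sq_nonneg _)
  refine hcont.exists_forall_le ?_
  refine Filter.tendsto_atTop_mono hlow ?_
  refine Filter.tendsto_atTop_add_const_left _ _ ?_
  refine Filter.Tendsto.const_mul_atTop (by positivity) ?_
  exact (Filter.tendsto_pow_atTop two_ne_zero).comp (tendsto_norm_cocompact_atTop (E := K → ℝ))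

lemma ell_stationary {S Y K : Type*}
    [Fintype S] [Fintype Y] [Nonempty Y] [Fintype K]
    (ytrain : S → Y) (ℓ : S → Y → ℝ) (φ : K → S → Y → ℝ)
    (ε C : ℝ) (hε : 0 < ε) (F : (K → ℝ) → ℝ) (hF : F = fun w =>
        (∑ s, (ε * Real.log (∑ y, Real.exp ((ℓ s y + ∑ k, w k * φ k s y) / ε))
            - ∑ k, w k * φ k s (ytrain s)))
          + (C / 2) * ∑ k, (w k) ^ 2) (w : K → ℝ) (hw : ∀ v, F w ≤ F v) (k : K) :
    (∑ s, ((∑ y, (Real.exp ((ℓ s y + ∑ k, w k * φ k s y) / ε) /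
      ∑ y, Real.exp ((ℓ s y + ∑ k, w k * φ k s y) / ε)) * φ k s y) - φ k s (ytrain s)))
      + C * w k = 0 := by
  classical
  have hlin : ∀ (t : ℝ) (g : K → ℝ), ∑ j, (w + t • (Pi.single k (1:ℝ) : K → ℝ)) j * g j
      = (∑ j, w j * g j) + t * g k := by
    intro t g
    simp [add_mul, Finset.sum_add_distrib, Pi.single_apply, ite_mul]
  have hsq : ∀ t : ℝ, ∑ j, ((w + t • (Pi.single k (1:ℝ) : K → ℝ)) j) ^ 2
      = (∑ j, (w j) ^ 2) + 2 * t * w k + t ^ 2 := by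
    intro t
    have : ∀ j, ((w + t • (Pi.single k (1:ℝ) : K → ℝ)) j) ^ 2
        = (w j) ^ 2 + (if j = k then 2 * t * w j + t ^ 2 else 0) := by
      intro j
      by_cases h : j = k
      · subst h; simp; ring
      · simp [h]
    simp only [this, Finset.sum_add_distrib]
    simp [add_assoc]
  have hG : (fun t : ℝ => F (w + t • (Pi.single k (1:ℝ) : K → ℝ))) = fun t : ℝ =>
      (∑ s, (ε * Real.log (∑ y, Real.exp (((ℓ s y + ∑ k, w k * φ k s y) + t * φ k s y) / ε))
            - ((∑ k, w k * φ k s (ytrain s)) + t * φ k s (ytrain s))))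
          + (C / 2) * ((∑ j, (w j) ^ 2) + 2 * t * w k + t ^ 2) := by
    funext t
    rw [hF]
    simp only [hsq]
    congr 1
    refine Finset.sum_congr rfl fun s _ => ?_
    rw [hlin t (fun k => φ k s (ytrain s))]
    congr 4
    funext y
    rw [hlin t (fun k => φ k s y), add_assoc]
  have hmin : IsLocalMin (fun t : ℝ => F (w + t • (Pi.single k (1:ℝ) : K → ℝ))) 0 := by
    refine Filter.Eventually.of_forall fun t => ?_
    simpa using hw _
  have hd1 : ∀ s ∈ (Finset.univ : Finset S), HasDerivAt (fun t : ℝ =>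
      (ε * Real.log (∑ y, Real.exp (((ℓ s y + ∑ k, w k * φ k s y) + t * φ k s y) / ε))
            - ((∑ k, w k * φ k s (ytrain s)) + t * φ k s (ytrain s))))
      ((∑ y, (Real.exp ((ℓ s y + ∑ k, w k * φ k s y) / ε) /
      ∑ y, Real.exp ((ℓ s y + ∑ k, w k * φ k s y) / ε)) * φ k s y) - 1 * φ k s (ytrain s)) 0 :=
    fun s _ => (ell_deriv (fun y => ℓ s y + ∑ k, w k * φ k s y) (φ k s) ε hε).sub
      (((hasDerivAt_id (0:ℝ)).mul_const _).const_add _)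
  have hd2 : HasDerivAt (fun t : ℝ => (C / 2) * ((∑ j, (w j) ^ 2) + 2 * t * w k + t ^ 2))
      (C * w k) 0 := by
    have := (((((hasDerivAt_id (0:ℝ)).const_mul 2).mul_const (w k)).const_add
      (∑ j, (w j) ^ 2)).add ((hasDerivAt_id (0:ℝ)).pow 2)).const_mul (C / 2)
    refine HasDerivAt.congr_deriv this ?_
    simp; ring
  have hd := (HasDerivAt.fun_sum hd1).add hd2
  rw [hG] at hmin
  have := hmin.hasDerivAt_eq_zero hd
  simpa only [one_mul] using this

/-- **strong duality for learning with the extended log-loss.**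
The infimum over `w` of the ε-regularized learning objective equals the maximum, over
families of probability distributions `(p_s)`, of entropy plus expected loss minus the
quadratic moment-matching penalty; the dual maximum is attained (and both values are
finite, being real numbers). -/
theorem extended_log_loss_strong_duality {S Y K : Type*}
    [Fintype S] [Nonempty S] [Fintype Y] [Nonempty Y] [Fintype K]
    (ytrain : S → Y) (ℓ : S → Y → ℝ) (φ : K → S → Y → ℝ)
    (ε C : ℝ) (hε : 0 < ε) (hC : 0 < C) :
    IsGreatest
      {dval : ℝ | ∃ p : S → Y → ℝ,
        (∀ s, (∀ y, 0 ≤ p s y) ∧ (∑ y, p s y) = 1) ∧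
        dval = (∑ s, (ε * (-∑ y, p s y * Real.log (p s y)) + ∑ y, p s y * ℓ s y))
          - (1 / (2 * C)) *
            ∑ k, (∑ s, ((∑ y, p s y * φ k s y) - φ k s (ytrain s))) ^ 2}
      (⨅ w : K → ℝ,
        (∑ s, (ε * Real.log (∑ y, Real.exp ((ℓ s y + ∑ k, w k * φ k s y) / ε))
            - ∑ k, w k * φ k s (ytrain s)))
          + (C / 2) * ∑ k, (w k) ^ 2) := by
  set F : (K → ℝ) → ℝ := fun w =>
        (∑ s, (ε * Real.log (∑ y, Real.exp ((ℓ s y + ∑ k, w k * φ k s y) / ε))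
            - ∑ k, w k * φ k s (ytrain s)))
          + (C / 2) * ∑ k, (w k) ^ 2 with hF
  obtain ⟨w, hw⟩ := ell_exists_min ytrain ℓ φ ε C hε hC F hF
  have hst := ell_stationary ytrain ℓ φ ε C hε F hF w hw
  have hinf : (⨅ v, F v) = F w :=
    le_antisymm (ciInf_le ⟨F w, by rintro _ ⟨v, rfl⟩; exact hw v⟩ w) (le_ciInf hw)
  rw [hinf]
  constructor
  · set p : S → Y → ℝ := fun s y => Real.exp ((ℓ s y + ∑ k, w k * φ k s y) / ε) /
      ∑ y, Real.exp ((ℓ s y + ∑ k, w k * φ k s y) / ε) with hp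
    have hg := fun s => ell_gibbs_eq (fun y => ℓ s y + ∑ k, w k * φ k s y) ε hε (p s)
      (fun y => rfl)
    refine ⟨p, fun s => ⟨(hg s).1, (hg s).2.1⟩, ?_⟩
    have hlin := ell_lin ytrain ℓ φ p w
    have hd : ∀ k, (∑ s, ((∑ y, p s y * φ k s y) - φ k s (ytrain s))) = - (C * w k) :=
      fun k => eq_neg_of_add_eq_zero_left (hst k)
    simp only [hd] at hlin ⊢
    have e1 : F w = (∑ s, ε * (-∑ y, p s y * Real.log (p s y)))
        + (∑ s, ((∑ y, p s y * (ℓ s y + ∑ k, w k * φ k s y)) - ∑ k, w k * φ k s (ytrain s)))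
        + (C / 2) * ∑ k, (w k) ^ 2 := by
      rw [← Finset.sum_add_distrib, hF]
      refine congrArg₂ (· + ·) (Finset.sum_congr rfl fun s _ => ?_) rfl
      have := (hg s).2.2
      linarith
    rw [e1, hlin, Finset.sum_add_distrib]
    have e2 : ∑ k, w k * -(C * w k) = -C * ∑ k, (w k) ^ 2 := by
      rw [Finset.mul_sum]; exact Finset.sum_congr rfl fun _ _ => by ring
    have e3 : ∑ k, (-(C * w k)) ^ 2 = C ^ 2 * ∑ k, (w k) ^ 2 := by
      rw [Finset.mul_sum]; exact Finset.sum_congr rfl fun _ _ => by ring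
    rw [e2, e3]
    field_simp
    ring
  · rintro _ ⟨p, hp, rfl⟩
    have hg := fun s => ell_gibbs (p s) (fun y => ℓ s y + ∑ k, w k * φ k s y) ε hε
      (hp s).1 (hp s).2
    have hlin := ell_lin ytrain ℓ φ p w
    have e1 : (∑ s, ε * (-∑ y, p s y * Real.log (p s y)))
        + (∑ s, ((∑ y, p s y * (ℓ s y + ∑ k, w k * φ k s y)) - ∑ k, w k * φ k s (ytrain s)))
        + (C / 2) * ∑ k, (w k) ^ 2 ≤ F w := by
      rw [← Finset.sum_add_distrib, hF]
      refine add_le_add (Finset.sum_le_sum fun s _ => ?_) le_rfl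
      have := hg s
      linarith
    refine le_trans ?_ e1
    rw [hlin, Finset.sum_add_distrib]
    have e2 : ∀ d : K → ℝ, 0 ≤ (∑ k, w k * d k) + (C / 2) * ∑ k, (w k) ^ 2
        + (1 / (2 * C)) * ∑ k, (d k) ^ 2 := by
      intro d
      rw [Finset.mul_sum, Finset.mul_sum, ← Finset.sum_add_distrib, ← Finset.sum_add_distrib]
      refine Finset.sum_nonneg fun k _ => ?_
      have : w k * d k + C / 2 * w k ^ 2 + 1 / (2 * C) * d k ^ 2
          = (C * w k + d k) ^ 2 / (2 * C) := by field_simp; ring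
      rw [this]; positivity
    have := e2 (fun k => ∑ s, ((∑ y, p s y * φ k s y) - φ k s (ytrain s)))
    linarith
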